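/- arXiv:2009.12550 — 2 statements merged into one kernel-verified Lean document; each statement's English description precedes it below -/
import Mathlib

section
/- Suppose |T| ≥ 2, |Q| ≥ 3, a_q ≤ b_1 and b_1·r + c < a_q for all q ∈ Q, Σ_{q∈Q} a_q ≤ b_t + c for all t ∈ T \ {1}, and Σ_{q∈Q} a_q − a_{q'} ≤ b_1(r + 1) + c < Σ_{q∈Q} a_q for every q' ∈ Q. Let (x̄, ȳ) ∈ X_LP with Σ_{t∈T\{1}} ȳ_t < 1, suppose Q̃ = {q ∈ Q : x̄_q > Σ_{t∈T\{1}} ȳ_t} equals Q, let d ∈ Q maximize x̄_q over q ∈ Q, and set s = (Σ_{q∈Q} x̄_q − Σ_{t∈T\{1}} ȳ_t)/(|Q| − 1). Then: if s ≤ x̄_d, the inequality x_d ≤ y_1 + (r+1)·Σ_{t∈T\{1}} y_t − r is an optimal solution of the separation problem for (x̄, ȳ); if x̄_d < s ≤ 1, the inequality (1/(|Q|−1)) Σ_{q∈Q} x_q ≤ y_1 + (r + |Q|/(|Q|−1))·Σ_{t∈T\{1}} y_t − r is an optimal solution; and if s > 1, the inequality Σ_{q∈Q} x_q ≤ y_1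 + (r+2)·Σ_{t∈T\{1}} y_t − r + |Q| − 2 is an optimal solution. Moreover, each of these three inequalities is facet-defining for P. (Here an inequality α^⊤x ≤ β^⊤y + γ with β_1 = 1 and β_t ≥ 0 for all t ∈ T that is valid for X is an optimal solution of the separation problem for (x̄, ȳ) if it maximizes x̄^⊤α − ȳ^⊤β − γ among all such triples (α, β, γ).) -/
open scoped BigOperators

/-- The unsplittable flow arc-set `X`. -/
def ufX {Q T : Type*} [Fintype Q] [Fintype T] (a : Q → ℝ) (b : T → ℝ) (c : ℝ) :
    Set ((Q → ℝ) × (T → ℝ)) :=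
  {p | (∀ q, p.1 q = 0 ∨ p.1 q = 1) ∧ (∀ t, ∃ n : ℕ, p.2 t = n) ∧
    ∑ q, a q * p.1 q ≤ ∑ t, b t * p.2 t + c}

/-- The unsplittable flow arc-set polyhedron `P = conv(X)`. -/
noncomputable def ufP {Q T : Type*} [Fintype Q] [Fintype T]
    (a : Q → ℝ) (b : T → ℝ) (c : ℝ) : Set ((Q → ℝ) × (T → ℝ)) :=
  convexHull ℝ (ufX a b c)

/-- The inequality `α᳐x ≤ β᳐y + γ` is valid for `P` (equivalently, holds on `X`). -/
def ufValid {Q T : Type*} [Fintype Q] [Fintype T] (a : Q → ℝ) (b : T → ℝ) (c : ℝ)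
    (α : Q → ℝ) (β : T → ℝ) (γ : ℝ) : Prop :=
  ∀ p ∈ ufX a b c, ∑ q, α q * p.1 q ≤ ∑ t, β t * p.2 t + γ

/-- The inequality `α᳐x ≤ β᳐y + γ` is facet-defining for `P`: it is valid and the
face `F = {(x,y) ∈ P : α᳐x = β᳐y + γ}` contains `|Q| + |T|` affinely independent
points. -/
noncomputable def ufFacet {Q T : Type*} [Fintype Q] [Fintype T]
    (a : Q → ℝ) (b : T → ℝ) (c : ℝ) (α : Q → ℝ) (β : T → ℝ) (γ : ℝ) : Prop :=
  ufValid a b c α β γ ∧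
  ∃ pts : Fin (Fintype.card Q + Fintype.card T) → (Q → ℝ) × (T → ℝ),
    (∀ i, pts i ∈ ufP a b c ∧
      ∑ q, α q * (pts i).1 q = ∑ t, β t * (pts i).2 t + γ) ∧
    AffineIndependent ℝ pts

/-- The linear relaxation `X_LP` of `X`. -/
def ufXLP {Q T : Type*} [Fintype Q] [Fintype T] (a : Q → ℝ) (b : T → ℝ) (c : ℝ) :
    Set ((Q → ℝ) × (T → ℝ)) :=
  {p | (∀ q, 0 ≤ p.1 q ∧ p.1 q ≤ 1) ∧ (∀ t, 0 ≤ p.2 t) ∧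
    ∑ q, a q * p.1 q ≤ ∑ t, b t * p.2 t + c}


/-- `(α, β, γ)` (with `β_1 = 1`, `β ≥ 0`, valid for `X`) is an optimal solution of
the separation problem for `(x̄, ȳ)`: it maximizes `x̄᳐α − ȳ᳐β − γ` among all
such triples. -/
def ufOptSol {Q T : Type*} [Fintype Q] [Fintype T]
    (a : Q → ℝ) (b : T → ℝ) (c : ℝ) (t1 : T) (xb : Q → ℝ) (yb : T → ℝ)
    (α : Q → ℝ) (β : T → ℝ) (γ : ℝ) : Prop :=
  β t1 = 1 ∧ (∀ t, 0 ≤ β t) ∧ ufValid a b c α β γ ∧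
  ∀ (α' : Q → ℝ) (β' : T → ℝ) (γ' : ℝ), β' t1 = 1 → (∀ t, 0 ≤ β' t) →
    ufValid a b c α' β' γ' →
    ∑ q, xb q * α' q - ∑ t, yb t * β' t - γ' ≤
      ∑ q, xb q * α q - ∑ t, yb t * β t - γ

section Helpers

variable {Q T : Type*} [Fintype Q] [Fintype T] {a : Q → ℝ} {b : T → ℝ} {c : ℝ}

lemma sum_ite_eq_one_mul [DecidableEq T] (t1 : T) (ρ : ℝ) (y : T → ℝ) :
    ∑ t, (if t = t1 then 1 else ρ) * y t = y t1 + ρ * ∑ t ∈ Finset.univ.erase t1, y t := by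
  rw [← Finset.add_sum_erase _ _ (Finset.mem_univ t1), Finset.mul_sum]
  congr 1
  · simp
  · refine Finset.sum_congr rfl fun t ht => ?_
    rw [if_neg (Finset.ne_of_mem_erase ht)]

lemma mem_ufX_single [DecidableEq T] {x : Q → ℝ} (hx : ∀ q, x q = 0 ∨ x q = 1) (t : T) (k : ℕ)
    (h : ∑ q, a q * x q ≤ b t * k + c) : (x, Pi.single t (k : ℝ)) ∈ ufX a b c := by
  refine ⟨hx, fun t' => ?_, ?_⟩
  · rcases eq_or_ne t' t with rfl | ht
    · exact ⟨k, by simp⟩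
    · exact ⟨0, by simp [ht]⟩
  · simpa [Pi.single_apply] using h

lemma sum_mul_le_sum (ha : ∀ q, 0 < a q) {x : Q → ℝ} (hx : ∀ q, x q = 0 ∨ x q = 1) :
    ∑ q, a q * x q ≤ ∑ q, a q :=
  Finset.sum_le_sum fun q _ => by rcases hx q with h | h <;> simp [h, (ha q).le]

lemma sum_mul_le_sum_sub (ha : ∀ q, 0 < a q) {x : Q → ℝ} (hx : ∀ q, x q = 0 ∨ x q = 1)
    {q' : Q} (hq' : x q' = 0) : ∑ q, a q * x q ≤ ∑ q, a q - a q' := by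
  classical
  rw [← Finset.add_sum_erase _ a (Finset.mem_univ q'),
    ← Finset.add_sum_erase _ (fun q => a q * x q) (Finset.mem_univ q'), hq']
  have : ∑ q ∈ Finset.univ.erase q', a q * x q ≤ ∑ q ∈ Finset.univ.erase q', a q :=
    Finset.sum_le_sum fun q _ => by rcases hx q with h | h <;> simp [h, (ha q).le]
  linarith

lemma sum_le_card_sub_one {x : Q → ℝ} (hx : ∀ q, x q = 0 ∨ x q = 1) {q' : Q} (hq' : x q' = 0) :
    ∑ q, x q ≤ (Fintype.card Q : ℝ) - 1 := by
  simpa using sum_mul_le_sum_sub (a := fun _ => (1 : ℝ)) (fun _ => one_pos) hx hq'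

/-- Every point of `X` either uses a facility other than `t1`, or only uses `t1`, in which case
`x` is zero, not all-ones, or arbitrary, according to whether `y_{t1}` is `N`, `N + 1` or more. -/
lemma ufX_cases [DecidableEq T] {t1 : T} (ha : ∀ q, 0 < a q) {N : ℕ}
    (hN : ∀ k : ℕ, 0 ≤ b t1 * k + c → N ≤ k) (h2 : ∀ q, b t1 * N + c < a q)
    (h3 : b t1 * (N + 1) + c < ∑ q, a q) {p : (Q → ℝ) × (T → ℝ)} (hp : p ∈ ufX a b c) :
    1 ≤ ∑ t ∈ Finset.univ.erase t1, p.2 t ∨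
    (∑ t ∈ Finset.univ.erase t1, p.2 t = 0 ∧
      ((p.2 t1 = N ∧ ∀ q, p.1 q = 0) ∨
       (p.2 t1 = N + 1 ∧ ∃ q, p.1 q = 0) ∨ (N : ℝ) + 2 ≤ p.2 t1)) := by
  obtain ⟨hx, hy, hle⟩ := hp
  choose n hn using hy
  by_cases h0 : ∀ t ∈ Finset.univ.erase t1, n t = 0
  · right
    have hz : ∀ t ∈ Finset.univ.erase t1, p.2 t = 0 := fun t ht => by simp [hn, h0 t ht]
    refine ⟨Finset.sum_eq_zero hz, ?_⟩
    rw [← Finset.add_sum_erase _ (fun t => b t * p.2 t) (Finset.mem_univ t1),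
      Finset.sum_eq_zero (s := Finset.univ.erase t1) fun t ht => by rw [hz t ht, mul_zero],
      hn t1, add_zero] at hle
    have hnn : ∀ q ∈ Finset.univ, 0 ≤ a q * p.1 q := fun q _ => by
      rcases hx q with h | h <;> simp [h, (ha q).le]
    have hNk := hN (n t1) ((Finset.sum_nonneg hnn).trans hle)
    rw [hn t1]
    rcases (by omega : n t1 = N ∨ n t1 = N + 1 ∨ N + 2 ≤ n t1) with h | h | h
    · refine Or.inl ⟨by rw [h], fun q => (hx q).resolve_right fun hq => ?_⟩
      have := Finset.single_le_sum hnn (Finset.mem_univ q)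
      have h2q := h2 q
      rw [h] at hle
      simp only [hq, mul_one] at this
      linarith
    · refine Or.inr (Or.inl ⟨by rw [h]; push_cast; rfl, ?_⟩)
      by_contra! hne
      have h1 : ∀ q, p.1 q = 1 := fun q => (hx q).resolve_left (hne q)
      simp only [h1, mul_one, h] at hle
      push_cast at hle
      linarith
    · exact Or.inr (Or.inr (by exact_mod_cast h))
  · left
    push Not at h0
    obtain ⟨t, ht, hnt⟩ := h0
    have := Finset.single_le_sum (f := p.2) (s := Finset.univ.erase t1)
      (fun t _ => by rw [hn t]; positivity) ht
    have h1 : (1 : ℝ) ≤ p.2 t := by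
      rw [hn t]; exact_mod_cast Nat.one_le_iff_ne_zero.2 hnt
    linarith

lemma ufValid.le_of_mem_ufP {α : Q → ℝ} {β : T → ℝ} {γ : ℝ} (h : ufValid a b c α β γ)
    {p : (Q → ℝ) × (T → ℝ)} (hp : p ∈ ufP a b c) :
    ∑ q, α q * p.1 q ≤ ∑ t, β t * p.2 t + γ := by
  have hlin : IsLinearMap ℝ fun p : (Q → ℝ) × (T → ℝ) =>
      ∑ q, α q * p.1 q - ∑ t, β t * p.2 t := by
    constructor
    · intro x y
      simp only [Prod.fst_add, Prod.snd_add, Pi.add_apply, mul_add, Finset.sum_add_distrib]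
      ring
    · intro r x
      simp only [Prod.smul_fst, Prod.smul_snd, Pi.smul_apply, smul_eq_mul, mul_sub,
        Finset.mul_sum, mul_left_comm]
  have := convexHull_min (fun x hx => sub_le_iff_le_add'.2 (h x hx))
    (convex_halfSpace_le hlin γ) hp
  exact sub_le_iff_le_add'.1 this

/-- A valid inequality is optimal as soon as it is tight at a point of `P` that differs from
`(xb, yb)` in the coordinate `t1` only. -/
lemma ufOptSol_of_tight [DecidableEq T] {t1 : T} {xb : Q → ℝ} {yb : T → ℝ} {α : Q → ℝ}
    {β : T → ℝ} {γ η : ℝ} (hβ1 : β t1 = 1) (hβ : ∀ t, 0 ≤ β t) (hv : ufValid a b c α β γ)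
    (hmem : (xb, Function.update yb t1 η) ∈ ufP a b c)
    (heq : ∑ q, α q * xb q = ∑ t, β t * Function.update yb t1 η t + γ) :
    ufOptSol a b c t1 xb yb α β γ := by
  refine ⟨hβ1, hβ, hv, fun α' β' γ' hβ1' _ hv' => ?_⟩
  have hle := hv'.le_of_mem_ufP hmem
  have key : ∀ δ : T → ℝ, δ t1 = 1 →
      ∑ t, δ t * Function.update yb t1 η t = ∑ t, yb t * δ t + (η - yb t1) := by
    intro δ hδ
    rw [← Finset.add_sum_erase _ _ (Finset.mem_univ t1),
      ← Finset.add_sum_erase _ (fun t => yb t * δ t) (Finset.mem_univ t1), hδ,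
      Finset.sum_congr rfl (g := fun t => yb t * δ t) fun t ht => by
        rw [Function.update_of_ne (Finset.ne_of_mem_erase ht), mul_comm]]
    simp only [Function.update_self]
    ring
  rw [key _ hβ1] at heq
  simp only [key _ hβ1'] at hle
  simp only [mul_comm (xb _)]
  linarith

/-- A convex set of vectors that contains all `0/1` vectors contains the unit cube. -/
lemma mem_of_cube {S : Set (Q → ℝ)} (hS : Convex ℝ S)
    (h : ∀ x : Q → ℝ, (∀ q, x q = 0 ∨ x q = 1) → x ∈ S) {x : Q → ℝ}
    (hx : ∀ q, 0 ≤ x q ∧ x q ≤ 1) : x ∈ S := by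
  have hsub : Set.univ.pi (fun _ : Q => ({0, 1} : Set ℝ)) ⊆ S := fun x hx =>
    h x fun q => by simpa using hx q (Set.mem_univ q)
  refine convexHull_min hsub hS ?_
  rw [convexHull_pi]
  intro q _
  rw [convexHull_pair, segment_eq_Icc zero_le_one]
  exact hx q

/-- A convex set of vectors that contains all `0/1` vectors other than the all-ones vector contains
every vector of the unit cube with coordinate sum at most `|Q| - 1`. -/
lemma mem_of_cube_of_sum_le {S : Set (Q → ℝ)} (hS : Convex ℝ S)
    (h : ∀ x : Q → ℝ, (∀ q, x q = 0 ∨ x q = 1) → (∃ q, x q = 0) → x ∈ S) {x : Q → ℝ}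
    (hx : ∀ q, 0 ≤ x q ∧ x q ≤ 1) (hsum : ∑ q, x q ≤ (Fintype.card Q : ℝ) - 1) : x ∈ S := by
  classical
  have hσ : 1 ≤ ∑ q, (1 - x q) := by
    simp only [Finset.sum_sub_distrib, Finset.sum_const, Finset.card_univ, nsmul_eq_mul, mul_one]
    linarith
  set σ := ∑ q, (1 - x q)
  have hne : (Finset.univ : Finset Q).Nonempty := by
    by_contra hne
    have : σ = 0 := by simp [σ, Finset.not_nonempty_iff_eq_empty.1 hne]
    linarith
  obtain ⟨m, -, hm⟩ := Finset.exists_min_image Finset.univ x hne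
  have hm1 : x m < 1 := by
    by_contra! hge
    have : σ ≤ 0 := Finset.sum_nonpos fun q hq => by linarith [hm q hq]
    linarith
  have hmσ : 1 - x m ≤ σ := Finset.single_le_sum (f := fun q => 1 - x q)
    (fun q _ => by linarith [(hx q).2]) (Finset.mem_univ m)
  -- the point where the ray from the all-ones vector through `x` leaves the cube
  have hfar : (fun q => 1 - (1 - x q) / (1 - x m)) ∈ S := by
    have hface : Set.univ.pi (fun q : Q => if q = m then ({0} : Set ℝ) else {0, 1}) ⊆ S := by
      intro y hy
      have hym : y m = 0 := by simpa using hy m (Set.mem_univ m)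
      refine h y (fun q => ?_) ⟨m, hym⟩
      rcases eq_or_ne q m with rfl | hq
      · exact Or.inl hym
      · simpa [hq] using hy q (Set.mem_univ q)
    refine convexHull_min hface hS ?_
    rw [convexHull_pi]
    intro q _
    rcases eq_or_ne q m with rfl | hq
    · simp [div_self (sub_pos.2 hm1).ne']
    · simp only [hq, if_false]
      rw [convexHull_pair, segment_eq_Icc zero_le_one]
      have h1 : 0 ≤ (1 - x q) / (1 - x m) :=
        div_nonneg (by linarith [(hx q).2]) (by linarith)
      have h2 : (1 - x q) / (1 - x m) ≤ 1 :=
        (div_le_one (by linarith)).2 (by linarith [hm q (Finset.mem_univ q)])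
      exact ⟨by linarith, by linarith⟩
  -- the point of the same ray on the simplex spanned by the vectors with a single zero
  have hnear : (fun q => 1 - (1 - x q) / σ) ∈ S := by
    have := hS.sum_mem (t := Finset.univ) (w := fun q => (1 - x q) / σ)
      (z := fun q q' => if q' = q then (0 : ℝ) else 1)
      (fun q _ => div_nonneg (by linarith [(hx q).2]) (by linarith))
      (by rw [← Finset.sum_div]; exact div_self (by linarith))
      (fun q _ => h _ (fun q' => by by_cases hq : q' = q <;> simp [hq]) ⟨q, by simp⟩)
    convert this using 1
    ext q'
    have hs : ∑ q, (1 - x q) / σ = 1 := by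
      rw [← Finset.sum_div]; exact div_self (by linarith)
    trans (∑ q, (1 - x q) / σ) - (1 - x q') / σ
    · rw [hs]
    rw [Finset.sum_apply,
      ← Finset.add_sum_erase _ _ (Finset.mem_univ q'),
      ← Finset.add_sum_erase _ (fun q => (((1 - x q) / σ) • fun q'' => if q'' = q then (0 : ℝ)
        else 1) q') (Finset.mem_univ q')]
    simp only [Pi.smul_apply, if_true, smul_eq_mul, mul_zero, zero_add, add_sub_cancel_left]
    exact Finset.sum_congr rfl fun q hq => by
      simp [(Finset.ne_of_mem_erase hq).symm]
  -- `x` lies between the two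
  set μ := 1 - x m
  have hμ : 0 < μ := by simp only [μ]; linarith
  have hσ0 : 0 < σ := by linarith
  have hμ1 : μ ≤ 1 := by simp only [μ]; linarith [(hx m).1]
  rcases hμ1.eq_or_lt with h1 | h1
  · rw [h1] at hfar
    simpa using hfar
  · have hd : 0 < σ - μ := by linarith
    have := hS hfar hnear (a := μ * (σ - 1) / (σ - μ)) (b := σ * (1 - μ) / (σ - μ))
      (div_nonneg (mul_nonneg hμ.le (by linarith)) hd.le)
      (div_nonneg (mul_nonneg hσ0.le (by linarith)) hd.le)
      (by field_simp; ring)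
    convert this using 1
    ext q
    simp only [Pi.add_apply, Pi.smul_apply, smul_eq_mul]
    field_simp
    ring

lemma convex_ufP : Convex ℝ (ufP a b c) := convex_convexHull ℝ _

lemma convex_fst_section (y : T → ℝ) : Convex ℝ {x : Q → ℝ | (x, y) ∈ ufP a b c} := by
  intro x hx x' hx' s t hs ht hst
  have := convex_ufP hx hx' hs ht hst
  rw [Prod.smul_mk, Prod.smul_mk, Prod.mk_add_mk, ← add_smul, hst, one_smul] at this
  exact this

/-- Combining a point of `P` that only uses `t1` with the points `(1, e_t)`, `t ≠ t1`. -/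
lemma update_mem_ufP [DecidableEq T] {t1 : T}
    (hother : ∀ t, t ≠ t1 → ((fun _ => 1 : Q → ℝ), Pi.single t (1 : ℝ)) ∈ ufP a b c)
    {xb : Q → ℝ} {yb : T → ℝ} (hyb : ∀ t, 0 ≤ yb t) {Y : ℝ}
    (hY : ∑ t ∈ Finset.univ.erase t1, yb t = Y) (hY1 : Y < 1) {η : ℝ}
    (h : ((fun q => (xb q - Y) / (1 - Y)), Pi.single t1 η) ∈ ufP a b c) :
    (xb, Function.update yb t1 ((1 - Y) * η)) ∈ ufP a b c := by
  have hsum : ∑ t, (if t = t1 then 1 - Y else yb t) = 1 := by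
    rw [← Finset.add_sum_erase _ _ (Finset.mem_univ t1), if_pos rfl,
      Finset.sum_congr rfl (g := yb) fun t ht => if_neg (Finset.ne_of_mem_erase ht), hY]
    ring
  have := convex_ufP.sum_mem (t := Finset.univ)
    (w := fun t => if t = t1 then 1 - Y else yb t)
    (z := fun t => if t = t1 then ((fun q => (xb q - Y) / (1 - Y)), Pi.single t1 η)
      else ((fun _ => 1 : Q → ℝ), Pi.single t (1 : ℝ)))
    (fun t _ => by split_ifs; exacts [by linarith, hyb t]) hsum
    (fun t _ => by
      by_cases ht : t = t1
      · simpa [ht] using h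
      · simpa [ht] using hother t ht)
  convert this using 1
  have hne : 1 - Y ≠ 0 := by linarith
  rw [← Finset.add_sum_erase _ _ (Finset.mem_univ t1), if_pos rfl, if_pos rfl,
    Finset.sum_congr rfl
      (g := fun t => yb t • ((fun _ => 1 : Q → ℝ), (Pi.single t (1 : ℝ) : T → ℝ))) fun t ht => by
        rw [if_neg (Finset.ne_of_mem_erase ht), if_neg (Finset.ne_of_mem_erase ht)]]
  ext i
  · simp only [Prod.fst_add, Prod.smul_fst, Prod.fst_sum, Pi.add_apply, Pi.smul_apply,
      Finset.sum_apply, smul_eq_mul, mul_one, hY]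
    field_simp
    ring
  · simp only [Prod.snd_add, Prod.smul_snd, Prod.snd_sum, Pi.add_apply, Pi.smul_apply,
      Finset.sum_apply, smul_eq_mul, Pi.single_apply, mul_ite, mul_one, mul_zero,
      Finset.sum_ite_eq, Finset.mem_erase, Finset.mem_univ, and_true]
    by_cases hi : i = t1
    · subst hi; simp
    · simp [hi]

lemma single_mem_ufP_of_sum_le [DecidableEq T] {t1 : T} {k : ℝ}
    (h0 : ((0 : Q → ℝ), Pi.single t1 k) ∈ ufP a b c)
    (h1 : ∀ x : Q → ℝ, (∀ q, x q = 0 ∨ x q = 1) → (∃ q, x q = 0) →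
      (x, Pi.single t1 (k + 1)) ∈ ufP a b c) {u : Q → ℝ} {τ : ℝ} (hτ : 0 < τ) (hτ1 : τ ≤ 1)
    (hu : ∀ q, 0 ≤ u q ∧ u q ≤ τ) (hsum : ∑ q, u q ≤ ((Fintype.card Q : ℝ) - 1) * τ) :
    (u, Pi.single t1 (k + τ)) ∈ ufP a b c := by
  have hu1 : ((fun q => u q / τ), Pi.single t1 (k + 1)) ∈ ufP a b c :=
    mem_of_cube_of_sum_le (convex_fst_section (Pi.single t1 (k + 1))) h1
      (fun q => ⟨div_nonneg (hu q).1 hτ.le, (div_le_one hτ).2 (hu q).2⟩)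
      (by rw [← Finset.sum_div]; exact (div_le_iff₀ hτ).2 hsum)
  have := convex_ufP h0 hu1 (sub_nonneg.2 hτ1) hτ.le (by ring)
  convert this using 1
  ext i
  · simp [mul_div_cancel₀ _ hτ.ne']
  · by_cases hi : i = t1
    · subst hi; simp; ring
    · simp [hi]

lemma single_mem_ufP_of_le_sum [DecidableEq T] {t1 : T} {k : ℝ}
    (h1 : ∀ x : Q → ℝ, (∀ q, x q = 0 ∨ x q = 1) → (∃ q, x q = 0) →
      (x, Pi.single t1 (k + 1)) ∈ ufP a b c)
    (h2 : ((fun _ => 1 : Q → ℝ), Pi.single t1 (k + 2)) ∈ ufP a b c) {u : Q → ℝ}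
    (hu : ∀ q, u q ≤ 1) (hsum : (Fintype.card Q : ℝ) - 1 ≤ ∑ q, u q) :
    (u, Pi.single t1 (k + 2 - (Fintype.card Q - ∑ q, u q))) ∈ ufP a b c := by
  set δ := (Fintype.card Q : ℝ) - ∑ q, u q with hδdef
  have hδs : δ = ∑ q, (1 - u q) := by simp [hδdef, Finset.sum_sub_distrib]
  have hle : ∀ q, 1 - u q ≤ δ := fun q => by
    rw [hδs]
    exact Finset.single_le_sum (f := fun q => 1 - u q)
      (fun q _ => by linarith [hu q]) (Finset.mem_univ q)
  have hδ0 : 0 ≤ δ := by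
    rw [hδs]; exact Finset.sum_nonneg fun q _ => by linarith [hu q]
  rcases hδ0.eq_or_lt with h0 | hpos
  · rw [← h0, sub_zero]
    convert h2 using 2
    ext q
    linarith [hle q, hu q]
  · have hmem : ((fun q => 1 - (1 - u q) / δ), Pi.single t1 (k + 1)) ∈ ufP a b c := by
      refine mem_of_cube_of_sum_le (convex_fst_section (Pi.single t1 (k + 1))) h1 (fun q => ?_) ?_
      · have h3 := div_nonneg (sub_nonneg.2 (hu q)) hδ0
        have h4 := (div_le_one hpos).2 (hle q)
        exact ⟨by linarith, by linarith⟩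
      · rw [Finset.sum_sub_distrib, ← Finset.sum_div, ← hδs, div_self hpos.ne']
        simp
    have := convex_ufP h2 hmem (show 0 ≤ 1 - δ by linarith) hδ0 (by ring)
    convert this using 1
    ext i
    · simp
      field_simp
      ring
    · by_cases hi : i = t1
      · subst hi; simp; ring
      · simp [hi]

/-- A valid inequality is facet-defining if it is tight at points `(f q, k e_{t1})`, `q ∈ Q`,
`(z, ρ e_{t1})` and `(g, e_t)`, `t ≠ t1`, of `X`, provided `f` and `z` are affinely independent. -/
lemma ufFacet_of_points [DecidableEq T] {t1 : T} {α : Q → ℝ} {β : T → ℝ} {γ : ℝ}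
    (hv : ufValid a b c α β γ) {f : Q → Q → ℝ} {z g : Q → ℝ} {k ρ : ℝ}
    (hf : ∀ q, (f q, Pi.single t1 k) ∈ ufX a b c)
    (hz : (z, Pi.single t1 ρ) ∈ ufX a b c)
    (hg : ∀ t, t ≠ t1 → (g, Pi.single t (1 : ℝ)) ∈ ufX a b c)
    (hf' : ∀ q, ∑ q', α q' * f q q' = β t1 * k + γ)
    (hz' : ∑ q', α q' * z q' = β t1 * ρ + γ)
    (hg' : ∀ t, t ≠ t1 → ∑ q', α q' * g q' = β t + γ)
    (hind : ∀ (u : Q → ℝ) (v : ℝ), ∑ q, u q + v = 0 →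
      (∀ q', ∑ q, u q * f q q' + v * z q' = 0) → ∀ q, u q = 0) :
    ufFacet a b c α β γ := by
  refine ⟨hv, ?_⟩
  let pts : Q ⊕ T → (Q → ℝ) × (T → ℝ) := Sum.elim (fun q => (f q, Pi.single t1 k))
    fun t => if t = t1 then (z, Pi.single t1 ρ) else (g, Pi.single t (1 : ℝ))
  have hmem : ∀ i, pts i ∈ ufX a b c ∧
      ∑ q, α q * (pts i).1 q = ∑ t, β t * (pts i).2 t + γ := by
    rintro (q | t)
    · exact ⟨hf q, by simpa [pts, Pi.single_apply] using hf' q⟩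
    · by_cases ht : t = t1
      · subst ht
        exact ⟨by simpa [pts] using hz, by simpa [pts, Pi.single_apply] using hz'⟩
      · exact ⟨by simpa [pts, ht] using hg t ht, by simpa [pts, ht, Pi.single_apply] using hg' t ht⟩
  have hai : AffineIndependent ℝ pts := by
    rw [affineIndependent_iff_of_fintype]
    intro w hw hws
    rw [Finset.weightedVSub_eq_linear_combination _ hw, Fintype.sum_sum_type] at hws
    rw [Fintype.sum_sum_type] at hw
    have hT : ∀ t, t ≠ t1 → w (Sum.inr t) = 0 := by
      intro t ht
      have := congrFun (congrArg Prod.snd hws) t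
      simp only [Prod.snd_add, Prod.snd_sum, Pi.add_apply, Finset.sum_apply, Prod.smul_snd,
        Pi.smul_apply, pts, Sum.elim_inl, Sum.elim_inr, smul_eq_mul, Pi.single_apply, ht,
        if_false, mul_zero, Finset.sum_const_zero, zero_add, Prod.snd_zero, Pi.zero_apply] at this
      rw [Finset.sum_eq_single t] at this
      · simpa [ht] using this
      · intro t' _ htt
        by_cases ht' : t' = t1 <;> simp [ht', ht, htt.symm]
      · simp
    rw [Finset.sum_eq_single (s := (Finset.univ : Finset T)) t1
      (fun t _ ht => hT t ht) (by simp)] at hw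
    have hu : ∀ q, w (Sum.inl q) = 0 := by
      refine hind _ _ hw fun q' => ?_
      rw [Finset.sum_eq_single (s := (Finset.univ : Finset T)) t1
        (fun t _ ht => by rw [hT t ht, zero_smul]) (by simp)] at hws
      have := congrFun (congrArg Prod.fst hws) q'
      simpa [pts, Prod.fst_sum] using this
    rintro (q | t)
    · exact hu q
    · by_cases ht : t = t1
      · subst ht
        simpa [hu] using hw
      · exact hT t ht
  let e : Fin (Fintype.card Q + Fintype.card T) ≃ Q ⊕ T :=
    Fintype.equivOfCardEq (by simp)
  exact ⟨pts ∘ e, fun i => ⟨subset_convexHull ℝ _ (hmem (e i)).1, (hmem (e i)).2⟩,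
    hai.comp_embedding e.toEmbedding⟩

end Helpers

/-- Proposition 8(d), multifacility, condition (6), `|Q| ≥ 3`,
`Q̃ = Q`: with `s = (Σ_q x̄_q − Σ_{t≠1} ȳ_t)/(|Q|−1)`, one of the three listed
inequalities solves the separation problem according to the case, and each of
the three is facet-defining for `P`. -/
theorem multifacility_case2_large {Q T : Type*} [Fintype Q] [Fintype T]
    [DecidableEq Q] [DecidableEq T]
    (a : Q → ℝ) (b : T → ℝ) (c : ℝ) (t1 : T)
    (ha : ∀ q, 0 < a q) (hb : ∀ t, 0 < b t) (hb1 : ∀ t, b t1 ≤ b t)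
    (hc : 0 < ∑ q, a q - c)
    (hT : 2 ≤ Fintype.card T)
    (hQ : 3 ≤ Fintype.card Q)
    (r : ℝ) (hr : r = max ((⌈-c / b t1⌉ : ℤ) : ℝ) 0)
    (h1 : ∀ q, a q ≤ b t1) (h2 : ∀ q, b t1 * r + c < a q)
    (hiii : ∀ t, t ≠ t1 → ∑ q, a q ≤ b t + c)
    (h3 : ∀ q' : Q, ∑ q, a q - a q' ≤ b t1 * (r + 1) + c ∧
      b t1 * (r + 1) + c < ∑ q, a q)
    (xb : Q → ℝ) (yb : T → ℝ) (hxy : (xb, yb) ∈ ufXLP a b c)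
    (hy : ∑ t ∈ Finset.univ.erase t1, yb t < 1)
    (hQtil : {q : Q | (∑ t ∈ Finset.univ.erase t1, yb t) < xb q} = Set.univ)
    (d : Q) (hd : ∀ q, xb q ≤ xb d)
    (s : ℝ)
    (hs : s = (∑ q, xb q - ∑ t ∈ Finset.univ.erase t1, yb t) /
      ((Fintype.card Q : ℝ) - 1)) :
    ((s ≤ xb d →
        ufOptSol a b c t1 xb yb (Pi.single d (1 : ℝ))
          (fun t => if t = t1 then 1 else r + 1) (-r)) ∧
     (xb d < s → s ≤ 1 →
        ufOptSol a b c t1 xb yb (fun _ => 1 / ((Fintype.card Q : ℝ) - 1))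
          (fun t => if t = t1 then 1
            else r + (Fintype.card Q : ℝ) / ((Fintype.card Q : ℝ) - 1)) (-r)) ∧
     (1 < s →
        ufOptSol a b c t1 xb yb (fun _ => (1 : ℝ))
          (fun t => if t = t1 then 1 else r + 2)
          (-r + (Fintype.card Q : ℝ) - 2))) ∧
    ufFacet a b c (Pi.single d (1 : ℝ))
      (fun t => if t = t1 then 1 else r + 1) (-r) ∧
    ufFacet a b c (fun _ => 1 / ((Fintype.card Q : ℝ) - 1))
      (fun t => if t = t1 then 1
        else r + (Fintype.card Q : ℝ) / ((Fintype.card Q : ℝ) - 1)) (-r) ∧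
    ufFacet a b c (fun _ => (1 : ℝ))
      (fun t => if t = t1 then 1 else r + 2)
      (-r + (Fintype.card Q : ℝ) - 2) := by
  obtain ⟨hx01, hyb, -⟩ := hxy
  simp only at hx01 hyb
  have hb0 := hb t1
  obtain ⟨N, rfl, hN0, hN⟩ : ∃ N : ℕ, r = N ∧ 0 ≤ b t1 * N + c ∧
      ∀ k : ℕ, 0 ≤ b t1 * k + c → N ≤ k := by
    have hcast : r = ((⌈-c / b t1⌉.toNat : ℕ) : ℝ) := by
      rw [hr, ← Int.cast_natCast, Int.toNat_eq_max]
      push_cast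
      rfl
    refine ⟨⌈-c / b t1⌉.toNat, hcast, ?_, fun k hk => ?_⟩
    · rw [← hcast]
      have : -c / b t1 ≤ r := (Int.le_ceil _).trans (hr ▸ le_max_left _ _)
      rw [div_le_iff₀ hb0] at this
      linarith
    · refine Int.toNat_le.2 (Int.ceil_le.2 ?_)
      rw [div_le_iff₀ hb0]
      push_cast
      linarith
  clear hr
  have hn : (3 : ℝ) ≤ Fintype.card Q := by exact_mod_cast hQ
  set n : ℝ := (Fintype.card Q : ℝ) with hndef
  have hn1 : 0 < n - 1 := by linarith
  -- points of `X`
  have m0 : ((0 : Q → ℝ), Pi.single t1 (N : ℝ)) ∈ ufX a b c :=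
    mem_ufX_single (fun q => Or.inl rfl) t1 N (by simpa using hN0)
  have m1 : ∀ x : Q → ℝ, (∀ q, x q = 0 ∨ x q = 1) → (∃ q, x q = 0) →
      (x, Pi.single t1 ((N : ℝ) + 1)) ∈ ufX a b c := by
    rintro x hx ⟨q, hq⟩
    have := mem_ufX_single (c := c) hx t1 (N + 1)
      ((sum_mul_le_sum_sub ha hx hq).trans (by push_cast; exact (h3 q).1))
    simpa using this
  have m2 : ((fun _ => 1 : Q → ℝ), Pi.single t1 ((N : ℝ) + 2)) ∈ ufX a b c := by
    have := mem_ufX_single (a := a) (b := b) (c := c) (x := fun _ => 1) (fun q => Or.inr rfl)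
      t1 (N + 2) (by
        have h3d := (h3 d).1
        have h1d := h1 d
        push_cast
        simp only [mul_one]
        linarith)
    simpa using this
  have m3 : ∀ x : Q → ℝ, (∀ q, x q = 0 ∨ x q = 1) → ∀ t, t ≠ t1 →
      (x, Pi.single t (1 : ℝ)) ∈ ufX a b c := fun x hx t ht => by
    have := mem_ufX_single (b := b) (c := c) hx t 1
      ((sum_mul_le_sum ha hx).trans (by simpa using hiii t ht))
    simpa using this
  have sub : ufX a b c ⊆ ufP a b c := subset_convexHull ℝ _
  have hne : ∀ q : Q, ∃ q', q' ≠ q ∧ q' ≠ d := fun q => by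
    have : ({q, d} : Finset Q).card < Fintype.card Q :=
      (Finset.card_le_two).trans_lt (by omega)
    obtain ⟨q', hmem⟩ := Finset.exists_mem_notMem_of_card_lt_card
      (s := {q, d}) (t := Finset.univ) (by simpa using this)
    exact ⟨q', by simpa using hmem.2⟩
  -- validity
  have hcases := fun p (hp : p ∈ ufX a b c) =>
    ufX_cases (t1 := t1) ha hN h2 (h3 d).2 hp
  have hnonneg : ∀ p ∈ ufX a b c, 0 ≤ p.2 t1 := fun p hp => by
    obtain ⟨k, hk⟩ := hp.2.1 t1
    rw [hk]; positivity
  have hN0' : (0 : ℝ) ≤ N := Nat.cast_nonneg N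
  have hsumle : ∀ p ∈ ufX a b c, ∑ q, p.1 q ≤ n := fun p hp => by
    simpa using sum_mul_le_sum (a := fun _ => (1 : ℝ)) (fun _ => one_pos) hp.1
  have vA : ufValid a b c (Pi.single d (1 : ℝ)) (fun t => if t = t1 then 1 else (N : ℝ) + 1)
      (-N) := by
    intro p hp
    rw [sum_ite_eq_one_mul]
    have hp1 : p.1 d ≤ 1 := by rcases hp.1 d with h | h <;> simp [h]
    have h0 := hnonneg p hp
    have hl : ∑ q, (Pi.single d (1 : ℝ) : Q → ℝ) q * p.1 q = p.1 d := by
      simp [Pi.single_apply]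
    rw [hl]
    rcases hcases p hp with h | ⟨hY, ⟨h, hx⟩ | ⟨h, -⟩ | h⟩
    · nlinarith
    · rw [hY, h, hx]; linarith
    · rw [hY]; linarith
    · rw [hY]; linarith
  have vB : ufValid a b c (fun _ => 1 / (n - 1))
      (fun t => if t = t1 then 1 else (N : ℝ) + n / (n - 1)) (-N) := by
    intro p hp
    rw [sum_ite_eq_one_mul, ← Finset.mul_sum, one_div_mul_eq_div]
    have h0 := hnonneg p hp
    have hle : (∑ q, p.1 q) / (n - 1) ≤ n / (n - 1) :=
      div_le_div_of_nonneg_right (hsumle p hp) hn1.le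
    have hpos : 0 < n / (n - 1) := by positivity
    rcases hcases p hp with h | ⟨hY, ⟨h, hx⟩ | ⟨h, q, hq⟩ | h⟩
    · nlinarith
    · rw [hY, h, Finset.sum_eq_zero fun q _ => hx q]; simp
    · have : (∑ q, p.1 q) / (n - 1) ≤ 1 :=
        (div_le_one hn1).2 (sum_le_card_sub_one hp.1 hq)
      rw [hY]; linarith
    · have : n / (n - 1) ≤ 2 := (div_le_iff₀ hn1).2 (by linarith)
      rw [hY]; linarith
  have vC : ufValid a b c (fun _ => (1 : ℝ)) (fun t => if t = t1 then 1 else (N : ℝ) + 2)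
      (-N + n - 2) := by
    intro p hp
    rw [sum_ite_eq_one_mul, ← Finset.mul_sum, one_mul]
    have h0 := hnonneg p hp
    have hle := hsumle p hp
    rcases hcases p hp with h | ⟨hY, ⟨h, hx⟩ | ⟨h, q, hq⟩ | h⟩
    · nlinarith
    · rw [hY, h, Finset.sum_eq_zero fun q _ => hx q]; linarith
    · have := sum_le_card_sub_one hp.1 hq
      rw [hY]; linarith
    · rw [hY]; linarith
  refine ⟨?_, ?_, ?_, ?_⟩
  · -- optimality
    set Y := ∑ t ∈ Finset.univ.erase t1, yb t with hYdef
    have hY0 : 0 ≤ Y := Finset.sum_nonneg fun t _ => hyb t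
    have hY1 : 0 < 1 - Y := by linarith
    have hYx : ∀ q, Y < xb q := fun q => by
      have : q ∈ {q : Q | Y < xb q} := hQtil ▸ Set.mem_univ q
      exact this
    have hsY : s * (n - 1) = ∑ q, xb q - Y := by rw [hs]; field_simp
    have hsumu : ∑ q, (xb q - Y) / (1 - Y) = (∑ q, xb q - n * Y) / (1 - Y) := by
      rw [← Finset.sum_div, Finset.sum_sub_distrib]
      simp [hndef]
    have hother : ∀ t, t ≠ t1 → ((fun _ => 1 : Q → ℝ), Pi.single t (1 : ℝ)) ∈ ufP a b c :=
      fun t ht => sub (m3 _ (fun _ => Or.inr rfl) t ht)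
    have hupd : ∀ η ρ : ℝ, ∑ t, (if t = t1 then 1 else ρ) * Function.update yb t1 η t =
        η + ρ * Y := fun η ρ => by
      rw [sum_ite_eq_one_mul, Function.update_self, Finset.sum_congr rfl fun t ht =>
        Function.update_of_ne (Finset.ne_of_mem_erase ht) η yb]
    have hlow : ∀ τ, (∀ q, xb q ≤ τ) → s ≤ τ → τ ≤ 1 →
        (xb, Function.update yb t1 ((1 - Y) * (N + (τ - Y) / (1 - Y)))) ∈ ufP a b c := by
      intro τ hxτ hsτ hτ1
      refine update_mem_ufP hother hyb hYdef.symm hy ?_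
      refine single_mem_ufP_of_sum_le (sub m0) (fun x hx hx' => sub (m1 x hx hx'))
        (div_pos (by linarith [hYx d, hxτ d]) hY1) ((div_le_one hY1).2 (by linarith))
        (fun q => ⟨div_nonneg (by linarith [hYx q]) hY1.le,
          div_le_div_of_nonneg_right (by linarith [hxτ q]) hY1.le⟩) ?_
      rw [hsumu, ← mul_div_assoc]
      refine div_le_div_of_nonneg_right ?_ hY1.le
      nlinarith
    have hif : ∀ ρ : ℝ, 0 ≤ ρ → ∀ t, (0 : ℝ) ≤ if t = t1 then 1 else ρ := fun ρ hρ t => by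
      split_ifs <;> linarith
    refine ⟨fun hcase => ?_, fun hcase hcase' => ?_, fun hcase => ?_⟩
    · refine ufOptSol_of_tight (if_pos rfl) (hif _ (by linarith)) vA
        (hlow (xb d) hd hcase (hx01 d).2) ?_
      rw [hupd]
      simp only [Pi.single_apply, ite_mul, one_mul, zero_mul, Finset.sum_ite_eq',
        Finset.mem_univ, if_true]
      field_simp
      ring
    · refine ufOptSol_of_tight (if_pos rfl) (hif _ (by positivity)) vB
        (hlow s (fun q => (hd q).trans hcase.le) le_rfl hcase') ?_
      rw [hupd, ← Finset.mul_sum, show ∑ q, xb q = s * (n - 1) + Y by linarith]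
      field_simp
      ring
    · have hmem : ((fun q => (xb q - Y) / (1 - Y)), Pi.single t1
          ((N : ℝ) + 2 - (n - ∑ q, (xb q - Y) / (1 - Y)))) ∈ ufP a b c := by
        refine single_mem_ufP_of_le_sum (fun x hx hx' => sub (m1 x hx hx')) (sub m2)
          (fun q => (div_le_one hY1).2 (by linarith [(hx01 q).2])) ?_
        rw [hsumu, le_div_iff₀ hY1]
        nlinarith
      refine ufOptSol_of_tight (if_pos rfl) (hif _ (by linarith)) vC
        (update_mem_ufP hother hyb hYdef.symm hy hmem) ?_
      rw [hupd, ← Finset.mul_sum, hsumu]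
      field_simp
      ring
  · refine ufFacet_of_points (t1 := t1) vA
      (f := fun q q' => if q' = q ∨ q' = d then 1 else 0)
      (fun q => m1 _ (fun q' => by
        by_cases h : q' = q ∨ q' = d
        · exact Or.inr (if_pos h)
        · exact Or.inl (if_neg h)) ?_)
      m0 (m3 (fun _ => 1) fun _ => Or.inr rfl) ?_ ?_ ?_ ?_
    · obtain ⟨q', h, h'⟩ := hne q
      exact ⟨q', by simp [h, h']⟩
    · intro q
      rw [Finset.sum_eq_single d (fun q' _ hq' => by simp [hq']) (by simp)]
      simp
    · simp
    · intro t ht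
      simp [Pi.single_apply, ht]
    · intro u v huv h
      have hu : ∀ q, q ≠ d → u q = 0 := fun q hq => by
        simpa [hq] using h q
      intro q
      rcases eq_or_ne q d with rfl | hq
      · have := h q
        simp only [or_true, if_true, mul_one, Pi.zero_apply, mul_zero, add_zero] at this
        rwa [Finset.sum_eq_single q (fun q' _ hq' => hu q' hq') (by simp)] at this
      · exact hu q hq
  all_goals
    have hfq : ∀ q : Q, ∑ q', (if q' = q then (0 : ℝ) else 1) = n - 1 := fun q => by
      rw [Finset.sum_ite]
      simp [Finset.filter_ne', Finset.card_erase_of_mem, hndef,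
        Nat.cast_sub (show 1 ≤ Fintype.card Q by omega)]
    have huf : ∀ (u : Q → ℝ) (q' : Q),
        ∑ q, u q * (if q' = q then (0 : ℝ) else 1) = ∑ q, u q - u q' := fun u q' => by
      rw [← Finset.add_sum_erase _ u (Finset.mem_univ q'),
        ← Finset.add_sum_erase _ (fun q => u q * _) (Finset.mem_univ q')]
      simp only [if_true, mul_zero, zero_add, add_sub_cancel_left]
      exact Finset.sum_congr rfl fun q hq => by simp [(Finset.ne_of_mem_erase hq).symm]
    have mf : ∀ q : Q, ((fun q' => if q' = q then (0 : ℝ) else 1), Pi.single t1 ((N : ℝ) + 1)) ∈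
        ufX a b c := fun q => m1 _ (fun q' => by by_cases h : q' = q <;> simp [h]) ⟨q, by simp⟩
  · refine ufFacet_of_points (t1 := t1) vB mf m0 (m3 (fun _ => 1) fun _ => Or.inr rfl)
      (fun q => ?_) ?_ (fun t ht => ?_) ?_
    · rw [← Finset.mul_sum, hfq]
      field_simp
      simp
    · simp
    · simp only [mul_one, ht, if_false, Finset.sum_const, Finset.card_univ, nsmul_eq_mul,
        ← hndef]
      field_simp
      ring
    · intro u v _ h q
      simp only [huf, Pi.zero_apply, mul_zero, add_zero] at h
      have hU : n * ∑ q, u q = ∑ q, u q := by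
        have : ∑ q', (∑ q, u q - u q') = 0 := Finset.sum_eq_zero fun q' _ => h q'
        rw [Finset.sum_sub_distrib] at this
        simp only [Finset.sum_const, Finset.card_univ, nsmul_eq_mul, ← hndef] at this
        linarith
      have hU0 : ∑ q, u q = 0 := by
        have : (n - 1) * ∑ q, u q = 0 := by linarith
        exact (mul_eq_zero.1 this).resolve_left hn1.ne'
      linarith [h q]
  · refine ufFacet_of_points (t1 := t1) vC mf m2 (m3 (fun _ => 1) fun _ => Or.inr rfl)
      (fun q => ?_) ?_ (fun t ht => ?_) ?_
    · rw [← Finset.mul_sum, hfq]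
      simp only [if_true]
      ring
    · simp only [mul_one, if_true, Finset.sum_const, Finset.card_univ, nsmul_eq_mul, ← hndef]
      ring
    · simp only [mul_one, ht, if_false, Finset.sum_const, Finset.card_univ, nsmul_eq_mul,
        ← hndef]
      ring
    · intro u v huv h q
      have hq := h q
      simp only [huf] at hq
      linarith
end

section
/- Suppose T = {1} and α^⊤x ≤ β_1 y_1 + γ is a nontrivial facet-defining inequality of P with β_1 = 1. Then for each q ∈ Q with a_q ≤ b_1 one has 0 ≤ α_q ≤ 1. -/
open scoped BigOperators

/-- The inequality `α᳐x ≤ β᳐y + γ` is nontrivial: it is not a positive scalar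
multiple of any of `−x_q ≤ 0`, `x_q ≤ 1`, `−y_t ≤ 0`, or
`Σ a_q x_q − Σ b_t y_t ≤ c`. -/
def ufNontrivial {Q T : Type*} [Fintype Q] [Fintype T] [DecidableEq Q] [DecidableEq T]
    (a : Q → ℝ) (b : T → ℝ) (c : ℝ) (α : Q → ℝ) (β : T → ℝ) (γ : ℝ) : Prop :=
  ¬ ∃ μ : ℝ, 0 < μ ∧
    ((∃ q : Q, α = -(μ • (Pi.single q (1 : ℝ) : Q → ℝ)) ∧ β = 0 ∧ γ = 0) ∨
     (∃ q : Q, α = μ • (Pi.single q (1 : ℝ) : Q → ℝ) ∧ β = 0 ∧ γ = μ) ∨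
     (∃ t : T, α = 0 ∧ β = μ • (Pi.single t (1 : ℝ) : T → ℝ) ∧ γ = 0) ∨
     (α = μ • a ∧ β = μ • b ∧ γ = μ * c))

/-- A linear functional that is constant on the points of `s` where the valid inequality
`f ≤ γ` is tight is constant on the face of `convexHull ℝ s` defined by `f = γ`. -/
theorem eq_of_mem_convexHull_of_tight {V : Type*} [AddCommGroup V] [Module ℝ V] {s : Set V}
    (f g : V →ₗ[ℝ] ℝ) {γ d : ℝ} (hf : ∀ p ∈ s, f p ≤ γ) (hg : ∀ p ∈ s, f p = γ → g p = d)
    {p : V} (hp : p ∈ convexHull ℝ s) (hpγ : f p = γ) : g p = d := by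
  have hsub : convexHull ℝ s ⊆ {p | f p ≤ γ ∧ (f p = γ → g p = d)} := by
    refine convexHull_min (fun p hp => ⟨hf p hp, hg p hp⟩) ?_
    rintro x ⟨hx, hx'⟩ y ⟨hy, hy'⟩ u v hu hv huv
    obtain rfl : u = 1 - v := by linarith
    simp only [Set.mem_ofPred_eq, map_add, map_smul, smul_eq_mul]
    refine ⟨by nlinarith, fun h => ?_⟩
    rcases hu.eq_or_lt with hu0 | hu0
    · obtain rfl : v = 1 := by linarith
      rw [hy' (by linarith)]
      ring
    rcases hv.eq_or_lt with rfl | hv0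
    · rw [hx' (by linarith)]
      ring
    · rw [hx' (by nlinarith), hy' (by nlinarith)]
      ring
  exact (hsub hp).2 hpγ

/-- A space does not contain as many affinely independent points as its dimension inside
a common level set of two linear functionals that are jointly surjective. -/
theorem not_affineIndependent_of_level_set {V : Type*} [AddCommGroup V] [Module ℝ V]
    [FiniteDimensional ℝ V] {n : ℕ} (hn : Module.finrank ℝ V = n) (f g : V →ₗ[ℝ] ℝ)
    (hfg : Function.Surjective (f.prod g)) {γ d : ℝ} {p : Fin n → V}
    (hf : ∀ i, f (p i) = γ) (hg : ∀ i, g (p i) = d) : ¬ AffineIndependent ℝ p := by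
  intro hp
  have hrank := (f.prod g).finrank_range_add_finrank_ker
  rw [LinearMap.range_eq_top.2 hfg, finrank_top, Module.finrank_prod, Module.finrank_self,
    hn] at hrank
  have hspan : vectorSpan ℝ (Set.range p) ≤ LinearMap.ker (f.prod g) := by
    rw [vectorSpan_def, Submodule.span_le]
    rintro _ ⟨_, ⟨i, rfl⟩, _, ⟨j, rfl⟩, rfl⟩
    simp [hf, hg]
  have hle := Submodule.finrank_mono hspan
  rw [hp.finrank_vectorSpan (n := n - 1) (by rw [Fintype.card_fin]; omega)] at hle
  omega

/-- A facet-defining inequality involving some `y_t` has no fixed coordinate `x_q` on its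
tight integer points. -/
theorem ufFacet.not_forall_coord_eq {Q T : Type*} [Fintype Q] [Fintype T]
    [DecidableEq Q] [DecidableEq T] {a : Q → ℝ} {b : T → ℝ} {c : ℝ}
    {α : Q → ℝ} {β : T → ℝ} {γ : ℝ} (h : ufFacet a b c α β γ) {t : T} (ht : β t ≠ 0)
    (q : Q) (d : ℝ) :
    ¬ ∀ p ∈ ufX a b c, ∑ q, α q * p.1 q = ∑ t, β t * p.2 t + γ → p.1 q = d := by
  intro hd
  obtain ⟨hval, pts, hpts, hind⟩ := h
  let f : (Q → ℝ) × (T → ℝ) →ₗ[ℝ] ℝ :=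
    (Fintype.linearCombination ℝ α).coprod (-Fintype.linearCombination ℝ β)
  let g : (Q → ℝ) × (T → ℝ) →ₗ[ℝ] ℝ := LinearMap.proj q ∘ₗ LinearMap.fst ℝ _ _
  have hf : ∀ p, f p = ∑ q, α q * p.1 q - ∑ t, β t * p.2 t := fun p => by
    simp [f, Fintype.linearCombination_apply, mul_comm, sub_eq_add_neg]
  have hg : ∀ p, g p = p.1 q := fun p => rfl
  have htight : ∀ i, f (pts i) = γ := fun i => by
    rw [hf]
    linarith [(hpts i).2]
  refine not_affineIndependent_of_level_set (by simp) f g ?_ htight (d := d)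
    (fun i => eq_of_mem_convexHull_of_tight f g (γ := γ) ?_ ?_ (hpts i).1 (htight i)) hind
  · rintro ⟨u, v⟩
    refine ⟨(Pi.single q v, Pi.single t ((α q * v - u) / β t)), ?_⟩
    ext
    · simp [hf, Pi.single_apply, mul_div_cancel₀, ht]
    · simp [hg]
  · intro p hp
    rw [hf]
    linarith [hval p hp]
  · intro p hp h
    rw [hf] at h
    exact hd p hp (by linarith)

/-- Changing one coordinate changes a weighted sum by the weighted difference. -/
theorem sum_mul_update {ι : Type*} [Fintype ι] [DecidableEq ι] (w x : ι → ℝ) (i : ι) (v : ℝ) :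
    ∑ j, w j * Function.update x i v j = ∑ j, w j * x j + w i * (v - x i) := by
  rw [← sub_eq_iff_eq_add', ← Finset.sum_sub_distrib, Finset.sum_eq_single i]
  · simp [mul_sub]
  · intro j _ hj
    simp [hj]
  · simp

/-- Lemma 2: if `T = {1}` and `α᳐x ≤ β_1 y_1 + γ` is a nontrivial
facet-defining inequality of `P` with `β_1 = 1`, then `0 ≤ α_q ≤ 1` for every
`q ∈ Q` with `a_q ≤ b_1`. -/
theorem single_facility_alpha_bounds {Q T : Type*} [Fintype Q] [Fintype T]
    [DecidableEq Q] [DecidableEq T]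
    (a : Q → ℝ) (b : T → ℝ) (c : ℝ) (t1 : T) (hT : ∀ t : T, t = t1)
    (ha : ∀ q, 0 < a q) (hb : ∀ t, 0 < b t) (hb1 : ∀ t, b t1 ≤ b t)
    (hc : 0 < ∑ q, a q - c)
    (α : Q → ℝ) (β : T → ℝ) (γ : ℝ) (hβ : β t1 = 1)
    (hfacet : ufFacet a b c α β γ)
    (hnt : ufNontrivial a b c α β γ) :
    ∀ q : Q, a q ≤ b t1 → 0 ≤ α q ∧ α q ≤ 1 := by
  intro q hq
  have hβ0 : β t1 ≠ 0 := by simp [hβ]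
  constructor
  · by_contra! hneg
    refine hfacet.not_forall_coord_eq hβ0 q 0 fun p hp htight => ?_
    refine (hp.1 q).resolve_right fun h1 => ?_
    have hv := hfacet.1 (Function.update p.1 q 0, p.2) ⟨fun r => ?_, hp.2.1, ?_⟩
    · simp only [sum_mul_update, h1] at hv
      linarith
    · by_cases hr : r = q
      · simp [hr]
      · simpa [hr] using hp.1 r
    · simp only [sum_mul_update, h1]
      linarith [hp.2.2, ha q]
  · by_contra! hgt
    refine hfacet.not_forall_coord_eq hβ0 q 1 fun p hp htight => ?_
    refine (hp.1 q).resolve_left fun h0 => ?_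
    have hv := hfacet.1 (Function.update p.1 q 1, Function.update p.2 t1 (p.2 t1 + 1))
      ⟨fun r => ?_, fun t => ?_, ?_⟩
    · simp only [sum_mul_update, h0, hβ] at hv
      linarith
    · by_cases hr : r = q
      · simp [hr]
      · simpa [hr] using hp.1 r
    · obtain ⟨n, hn⟩ := hp.2.1 t1
      exact ⟨n + 1, by simp [hT t, hn]⟩
    · simp only [sum_mul_update, h0]
      linarith [hp.2.2]
end
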